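/- Let μ > 0 be a non-integer real number and set Δ = μ − ⌊μ⌋ ∈ (0,1). Suppose for each ν > 0, λ(ν) > 0 satisfies the mean constraint Σ_{y=0}^∞ (y − μ) λ(ν)^y/(y!)^ν = 0. Then for all sufficiently large ν, the ratio of CMP probabilities at ⌊μ⌋ and ⌈μ⌉ satisfies 1 − Δ < P_ν(Y = ⌊μ⌋)/P_ν(Y = ⌈μ⌉) < 1/Δ, and this ratio converges to (1 − Δ)/Δ as ν → ∞. -/

import Mathlib

open Filter Real Topology

/-- Normalizing function of the Conway–Maxwell–Poisson distribution:
`Z(λ, ν) = ∑_{y=0}^∞ λ^y / (y!)^ν`. -/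
noncomputable def cmpZ (l ν : ℝ) : ℝ := ∑' y : ℕ, l ^ y / (y.factorial : ℝ) ^ ν

/-- pmf of the CMP distribution: `P(Y = y) = λ^y / ((y!)^ν Z(λ, ν))`. -/
noncomputable def cmpPmf (l ν : ℝ) (y : ℕ) : ℝ :=
  l ^ y / (y.factorial : ℝ) ^ ν / cmpZ l ν

/-- The mean constraint `∑_{y=0}^∞ (y − μ) λ^y / (y!)^ν = 0`. -/
def meanConstraint (μ l ν : ℝ) : Prop :=
  ∑' y : ℕ, ((y : ℝ) - μ) * l ^ y / (y.factorial : ℝ) ^ ν = 0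

theorem le_max_of_hasSum_mean_zero {n : ℕ} {μ t ν : ℝ} {g : ℕ → ℝ} (hn : (n : ℝ) < μ)
    (hn1 : μ < n + 1) (hg0 : ∀ y, 0 ≤ g y) (hg1 : ∀ y, g y ≤ 1) (hgm : g (n + 1) = 1)
    (hν : 1 ≤ ν) (ht : 0 < t) (hs : HasSum (fun y : ℕ => ((y : ℝ) - μ) * (t ^ y * g y ^ ν)) 0) :
    t ≤ max 1 ((n + 1) * μ / (n + 1 - μ)) := by
  rcases le_total t 1 with h1 | h1
  · exact le_max_of_le_left h1
  refine le_max_of_le_right ?_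
  have hμ : 0 < μ := lt_of_le_of_lt (Nat.cast_nonneg n) hn
  have hfin : HasSum (fun y => if y ∈ Finset.range (n + 1) then μ * t ^ n else 0)
      (∑ y ∈ Finset.range (n + 1), if y ∈ Finset.range (n + 1) then μ * t ^ n else 0) :=
    hasSum_sum_of_ne_finset_zero fun y hy => if_neg hy
  have hsum := hs.add hfin
  have hnn : ∀ y : ℕ, 0 ≤ ((y : ℝ) - μ) * (t ^ y * g y ^ ν) +
      (if y ∈ Finset.range (n + 1) then μ * t ^ n else 0) := by
    intro y
    have hgp : 0 ≤ g y ^ ν := rpow_nonneg (hg0 y) ν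
    have hp : 0 ≤ t ^ y * g y ^ ν := mul_nonneg (pow_nonneg ht.le y) hgp
    split_ifs with hy
    · have hyn : y ≤ n := Nat.lt_succ_iff.mp (Finset.mem_range.mp hy)
      have hle : t ^ y * g y ^ ν ≤ t ^ n := by
        calc t ^ y * g y ^ ν ≤ t ^ y * 1 := by
              gcongr
              exact rpow_le_one (hg0 y) (hg1 y) (by linarith)
          _ ≤ t ^ n := by rw [mul_one]; exact pow_le_pow_right₀ h1 hyn
      have hy0 : (0 : ℝ) ≤ y := Nat.cast_nonneg y
      nlinarith [mul_nonneg hy0 hp]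
    · have hyn : n + 1 ≤ y := by simpa using hy
      have : (n : ℝ) + 1 ≤ y := by exact_mod_cast hyn
      rw [add_zero]
      exact mul_nonneg (by linarith) hp
  have hkey := le_hasSum hsum (n + 1) fun y _ => hnn y
  simp only [hgm, one_rpow, Finset.mem_range, lt_irrefl, if_false, add_zero, zero_add, mul_one,
    Nat.cast_add, Nat.cast_one] at hkey
  rw [Finset.sum_congr rfl (fun y hy => if_pos (Finset.mem_range.mp hy)), Finset.sum_const,
    Finset.card_range, nsmul_eq_mul, pow_succ] at hkey
  push_cast at hkey
  have htn : 0 < t ^ n := pow_pos ht n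
  rw [le_div_iff₀ (by linarith)]
  refine le_of_mul_le_mul_left ?_ htn
  linarith

theorem le_mul_tsum_of_hasSum_mean_zero {n : ℕ} {μ t ν : ℝ} {g : ℕ → ℝ}
    (hn1 : μ < n + 1) (hg0 : ∀ y, 0 ≤ g y) (hg1 : ∀ y, g y ≤ 1) (hgn : g n = 1)
    (hgs : Summable fun y : ℕ => |(y : ℝ) - μ| * g y)
    (hn : (n : ℝ) < μ) (hν : 1 ≤ ν) (ht : 0 < t) (ht1 : t ≤ 1)
    (hs : HasSum (fun y : ℕ => ((y : ℝ) - μ) * (t ^ y * g y ^ ν)) 0) :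
    μ - n ≤ t * ∑' y : ℕ, |(y : ℝ) - μ| * g y := by
  have hsum := (hgs.hasSum.mul_left (t ^ (n + 1))).sub hs
  have hnn : ∀ y : ℕ, 0 ≤ t ^ (n + 1) * (|(y : ℝ) - μ| * g y) -
      ((y : ℝ) - μ) * (t ^ y * g y ^ ν) := by
    intro y
    have hp : 0 ≤ t ^ y * g y ^ ν := mul_nonneg (pow_nonneg ht.le y) (rpow_nonneg (hg0 y) ν)
    have hq : 0 ≤ t ^ (n + 1) * (|(y : ℝ) - μ| * g y) :=
      mul_nonneg (pow_nonneg ht.le _) (mul_nonneg (abs_nonneg _) (hg0 y))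
    rcases le_or_gt y n with hy | hy
    · have : (y : ℝ) ≤ n := by exact_mod_cast hy
      nlinarith
    · have hy' : n + 1 ≤ y := hy
      have : (n : ℝ) + 1 ≤ y := by exact_mod_cast hy'
      rw [abs_of_nonneg (by linarith), sub_nonneg]
      have hle : t ^ y * g y ^ ν ≤ t ^ (n + 1) * g y :=
        mul_le_mul (pow_le_pow_of_le_one ht.le ht1 hy')
          (rpow_le_self_of_le_one (hg0 y) (hg1 y) hν) (rpow_nonneg (hg0 y) ν)
          (pow_nonneg ht.le _)
      calc ((y : ℝ) - μ) * (t ^ y * g y ^ ν) ≤ (y - μ) * (t ^ (n + 1) * g y) :=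
            mul_le_mul_of_nonneg_left hle (by linarith)
        _ = _ := by ring
  have hkey := le_hasSum hsum n fun y _ => hnn y
  simp only [hgn, one_rpow, mul_one, sub_zero] at hkey
  have htn : 0 < t ^ n := pow_pos ht n
  have h0 : 0 ≤ t ^ (n + 1) * |(n : ℝ) - μ| := by positivity
  refine le_of_mul_le_mul_left ?_ htn
  rw [pow_succ] at *
  linarith

/-- If the weights `t ^ y * g y ^ ν` have mean `μ ∈ (n, n + 1)`, where `g` is maximal exactly at
`n` and `n + 1`, then `t` converges to the odds `(μ - n) / (n + 1 - μ)` as `ν → ∞`. -/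
theorem tendsto_of_hasSum_mean_zero {n : ℕ} {μ : ℝ} {g : ℕ → ℝ} {x : ℝ → ℝ}
    (hn : (n : ℝ) < μ) (hn1 : μ < n + 1) (hg0 : ∀ y, 0 ≤ g y) (hgn : g n = 1)
    (hgm : g (n + 1) = 1) (hglt : ∀ y, y ≠ n → y ≠ n + 1 → g y < 1)
    (hgs : ∀ C : ℝ, Summable fun y : ℕ => |(y : ℝ) - μ| * (C ^ y * g y))
    (hx : ∀ ν : ℝ, 1 ≤ ν → 0 < x ν)
    (hs : ∀ ν : ℝ, 1 ≤ ν → HasSum (fun y : ℕ => ((y : ℝ) - μ) * (x ν ^ y * g y ^ ν)) 0) :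
    Tendsto x atTop (𝓝 ((μ - n) / (n + 1 - μ))) := by
  have hg1 : ∀ y, g y ≤ 1 := by
    intro y
    by_cases h1 : y = n
    · rw [h1, hgn]
    by_cases h2 : y = n + 1
    · rw [h2, hgm]
    exact (hglt y h1 h2).le
  set C : ℝ := max 1 ((n + 1) * μ / (n + 1 - μ)) with hC
  have hC0 : 0 < C := lt_of_lt_of_le one_pos (le_max_left _ _)
  have hxC : ∀ ν, 1 ≤ ν → x ν ≤ C := fun ν hν =>
    le_max_of_hasSum_mean_zero hn hn1 hg0 hg1 hgm hν (hx ν hν) (hs ν hν)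
  obtain ⟨c, hc0, hxc⟩ : ∃ c : ℝ, 0 < c ∧ ∀ ν, 1 ≤ ν → c ≤ x ν := by
    have hgs1 : Summable fun y : ℕ => |(y : ℝ) - μ| * g y := by simpa using hgs 1
    set S := ∑' y : ℕ, |(y : ℝ) - μ| * g y with hS
    have hS0 : 0 < S := hgs1.tsum_pos (fun y => mul_nonneg (abs_nonneg _) (hg0 y)) n
      (by rw [hgn, mul_one]; exact abs_pos.mpr (by linarith))
    refine ⟨min 1 ((μ - n) / S), lt_min one_pos (div_pos (by linarith) hS0), fun ν hν => ?_⟩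
    rcases le_total (x ν) 1 with h1 | h1
    · refine (min_le_right _ _).trans ?_
      rw [div_le_iff₀ hS0]
      exact le_mul_tsum_of_hasSum_mean_zero hn1 hg0 hg1 hgn hgs1 hn hν (hx ν hν) h1 (hs ν hν)
    · exact (min_le_left _ _).trans h1
  let F : ℝ → ℕ → ℝ := fun ν y =>
    if y = n ∨ y = n + 1 then 0 else ((y : ℝ) - μ) * (x ν ^ y * g y ^ ν)
  have hFsum : ∀ ν, 1 ≤ ν → ∑' y, F ν y = -(x ν ^ n * ((n + 1 - μ) * x ν - (μ - n))) := by
    intro ν hν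
    have h := ((hs ν hν).sub (hasSum_ite_eq n (((n : ℝ) - μ) * (x ν ^ n)))).sub
      (hasSum_ite_eq (n + 1) (((n : ℝ) + 1 - μ) * (x ν ^ (n + 1))))
    have h2 : HasSum (F ν) (0 - ((n : ℝ) - μ) * (x ν ^ n) -
        ((n : ℝ) + 1 - μ) * (x ν ^ (n + 1))) := by
      have hF : F ν = fun y : ℕ => ((y : ℝ) - μ) * (x ν ^ y * g y ^ ν) -
          (if y = n then ((n : ℝ) - μ) * x ν ^ n else 0) -
          (if y = n + 1 then ((n : ℝ) + 1 - μ) * x ν ^ (n + 1) else 0) := by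
        funext y
        by_cases h1 : y = n
        · simp [F, h1, hgn]
        by_cases h2 : y = n + 1
        · simp [F, h2, hgm]
        simp [F, h1, h2]
      rw [hF]
      exact h
    rw [h2.tsum_eq]
    ring
  have hFlim : Tendsto (fun ν => ∑' y, F ν y) atTop (𝓝 (∑' _ : ℕ, (0 : ℝ))) := by
    refine tendsto_tsum_of_dominated_convergence (hgs C) (fun y => ?_) ?_
    · by_cases hy : y = n ∨ y = n + 1
      · simp only [F, if_pos hy]
        exact tendsto_const_nhds
      simp only [F, if_neg hy]
      push Not at hy
      have hlim : Tendsto (fun ν : ℝ => |(y : ℝ) - μ| * (C ^ y * g y ^ ν)) atTop (𝓝 0) := by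
        simpa using ((tendsto_rpow_atTop_of_base_lt_one (g y) (by linarith [hg0 y])
          (hglt y hy.1 hy.2)).const_mul (C ^ y)).const_mul |(y : ℝ) - μ|
      refine squeeze_zero_norm' ?_ hlim
      filter_upwards [eventually_ge_atTop 1] with ν hν
      have hgp := rpow_nonneg (hg0 y) ν
      rw [norm_mul, norm_eq_abs, norm_eq_abs,
        abs_of_nonneg (mul_nonneg (pow_nonneg (hx ν hν).le y) hgp)]
      have := (hx ν hν).le
      gcongr
      exact hxC ν hν
    · filter_upwards [eventually_ge_atTop 1] with ν hν y
      have hgp := rpow_nonneg (hg0 y) ν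
      have hx0 := (hx ν hν).le
      by_cases hy : y = n ∨ y = n + 1
      · simp only [F, if_pos hy, norm_zero]
        exact mul_nonneg (abs_nonneg _) (mul_nonneg (pow_nonneg hC0.le y) (hg0 y))
      simp only [F, if_neg hy]
      rw [norm_mul, norm_eq_abs, norm_eq_abs, abs_of_nonneg (mul_nonneg (pow_nonneg hx0 y) hgp)]
      gcongr
      · exact hxC ν hν
      · exact rpow_le_self_of_le_one (hg0 y) (hg1 y) hν
  rw [tsum_zero] at hFlim
  have hlin : Tendsto (fun ν => (n + 1 - μ) * x ν - (μ - n)) atTop (𝓝 0) := by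
    have hlim : Tendsto (fun ν => ‖∑' y, F ν y‖ / c ^ n) atTop (𝓝 0) := by
      simpa using hFlim.norm.div_const (c ^ n)
    refine squeeze_zero_norm' ?_ hlim
    filter_upwards [eventually_ge_atTop 1] with ν hν
    rw [hFsum ν hν, norm_neg, norm_mul, norm_pow, norm_of_nonneg (hx ν hν).le,
      le_div_iff₀ (pow_pos hc0 n), mul_comm]
    gcongr
    exact hxc ν hν
  have hd : (n : ℝ) + 1 - μ ≠ 0 := by linarith
  have := (hlin.add_const (μ - n)).div_const ((n : ℝ) + 1 - μ)
  rw [zero_add] at this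
  refine this.congr fun ν => ?_
  field_simp
  ring

theorem pow_div_factorial_succ (m : ℝ) (y : ℕ) :
    m ^ (y + 1) / ((y + 1).factorial : ℝ) = m ^ y / (y.factorial : ℝ) * (m / (y + 1)) := by
  rw [Nat.factorial_succ, pow_succ]
  push_cast
  rw [mul_div_mul_comm, mul_comm, mul_comm (m ^ y / _), mul_comm]
  field_simp

theorem pow_div_factorial_self_pred (n : ℕ) :
    ((n : ℝ) + 1) ^ (n + 1) / ((n + 1).factorial : ℝ) = ((n : ℝ) + 1) ^ n / (n.factorial : ℝ) := by
  rw [pow_div_factorial_succ, div_self (by positivity), mul_one]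

/-- The Poisson weights with integer rate `n + 1` are maximal only at `n` and `n + 1`. -/
theorem pow_div_factorial_lt {n y : ℕ} (h1 : y ≠ n) (h2 : y ≠ n + 1) :
    ((n : ℝ) + 1) ^ y / (y.factorial : ℝ) < ((n : ℝ) + 1) ^ (n + 1) / ((n + 1).factorial : ℝ) := by
  have hpos : ∀ y : ℕ, 0 < ((n : ℝ) + 1) ^ y / (y.factorial : ℝ) := fun y => by positivity
  rcases lt_or_gt_of_ne h1 with h | h
  · rw [pow_div_factorial_self_pred]
    have hstep : ∀ z : ℕ, z < n → ((n : ℝ) + 1) ^ z / (z.factorial : ℝ) <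
        ((n : ℝ) + 1) ^ (z + 1) / ((z + 1).factorial : ℝ) := by
      intro z hz
      rw [pow_div_factorial_succ]
      refine lt_mul_of_one_lt_right (hpos z) ?_
      rw [one_lt_div (by positivity)]
      exact_mod_cast Nat.succ_lt_succ hz
    exact strictMonoOn_of_lt_add_one (Set.ordConnected_Iic (a := n))
      (f := fun z : ℕ => ((n : ℝ) + 1) ^ z / (z.factorial : ℝ))
      (fun z _ _ hz => hstep z (Nat.lt_of_succ_le hz)) h.le Set.self_mem_Iic h
  · have h3 : n + 2 ≤ y := by omega
    clear h1 h2 h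
    induction y, h3 using Nat.le_induction with
    | base =>
      rw [pow_div_factorial_succ _ (n + 1)]
      refine mul_lt_of_lt_one_right (hpos _) ?_
      rw [div_lt_one (by positivity)]
      push_cast
      linarith
    | succ k hk ih =>
      refine lt_of_le_of_lt ?_ ih
      rw [pow_div_factorial_succ]
      refine mul_le_of_le_one_right (hpos _).le ?_
      rw [div_le_one (by positivity)]
      have : (n : ℝ) + 2 ≤ k := by exact_mod_cast hk
      linarith

theorem summable_abs_sub_mul_pow_div_factorial (μ a : ℝ) :
    Summable fun y : ℕ => |(y : ℝ) - μ| * (a ^ y / (y.factorial : ℝ)) := by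
  refine Summable.of_norm_bounded
    ((summable_pow_div_factorial (2 * |a|)).mul_left (1 + |μ|)) fun y => ?_
  rw [norm_mul, norm_div, norm_pow, norm_eq_abs, norm_eq_abs, abs_abs, norm_natCast, mul_pow,
    mul_div_assoc, ← mul_assoc]
  gcongr
  have h1 : (y : ℝ) ≤ 2 ^ y := by exact_mod_cast Nat.lt_two_pow_self.le
  have h2 : (1 : ℝ) ≤ 2 ^ y := one_le_pow₀ one_le_two
  have h3 : |(y : ℝ) - μ| ≤ y + |μ| := by
    simpa using abs_sub (y : ℝ) μ
  nlinarith [abs_nonneg μ]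

/-- The factor of the CMP weights that is raised to the power `ν`, normalised to be `1` at `n` and
`n + 1`. -/
noncomputable def cmpShape (n y : ℕ) : ℝ :=
  ((n : ℝ) + 1) ^ y / (y.factorial : ℝ) / (((n : ℝ) + 1) ^ (n + 1) / ((n + 1).factorial : ℝ))

theorem cmpShape_nonneg (n y : ℕ) : 0 ≤ cmpShape n y := by
  unfold cmpShape
  positivity

theorem cmpShape_self (n : ℕ) : cmpShape n n = 1 := by
  rw [cmpShape, pow_div_factorial_self_pred, div_self (by positivity)]

theorem cmpShape_succ (n : ℕ) : cmpShape n (n + 1) = 1 :=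
  div_self (by positivity)

theorem cmpShape_lt_one {n y : ℕ} (h1 : y ≠ n) (h2 : y ≠ n + 1) : cmpShape n y < 1 := by
  rw [cmpShape, div_lt_one (by positivity)]
  exact pow_div_factorial_lt h1 h2

theorem cmpShape_le_one (n y : ℕ) : cmpShape n y ≤ 1 := by
  by_cases h1 : y = n
  · rw [h1, cmpShape_self]
  by_cases h2 : y = n + 1
  · rw [h2, cmpShape_succ]
  exact (cmpShape_lt_one h1 h2).le

theorem summable_abs_sub_mul_cmpShape (n : ℕ) (μ C : ℝ) :
    Summable fun y : ℕ => |(y : ℝ) - μ| * (C ^ y * cmpShape n y) := by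
  refine ((summable_abs_sub_mul_pow_div_factorial μ (C * (n + 1))).div_const
    (((n : ℝ) + 1) ^ (n + 1) / ((n + 1).factorial : ℝ))).congr fun y => ?_
  rw [cmpShape, mul_pow]
  ring

theorem cmp_weight_eq (n y : ℕ) {l : ℝ} (hl : 0 < l) (ν : ℝ) :
    l ^ y / (y.factorial : ℝ) ^ ν = (l / ((n : ℝ) + 1) ^ ν) ^ y * cmpShape n y ^ ν *
      (((n : ℝ) + 1) ^ (n + 1) / ((n + 1).factorial : ℝ)) ^ ν := by
  have hm : (0 : ℝ) < n + 1 := by positivity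
  rw [mul_assoc, ← mul_rpow (cmpShape_nonneg n y) (by positivity), cmpShape,
    div_mul_cancel₀ _ (by positivity), div_rpow (by positivity) (by positivity), div_pow,
    ← rpow_natCast ((n : ℝ) + 1) y, ← rpow_mul hm.le, mul_comm (y : ℝ) ν, rpow_mul hm.le,
    rpow_natCast]
  have : (((n : ℝ) + 1) ^ ν) ^ y ≠ 0 := by positivity
  field_simp

theorem summable_mul_cmpShape_rpow (n : ℕ) (μ : ℝ) {t ν : ℝ} (ht : 0 < t) (hν : 1 ≤ ν) :
    Summable fun y : ℕ => ((y : ℝ) - μ) * (t ^ y * cmpShape n y ^ ν) := by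
  refine Summable.of_norm_bounded (summable_abs_sub_mul_cmpShape n μ t) fun y => ?_
  have hgp := rpow_nonneg (cmpShape_nonneg n y) ν
  rw [norm_mul, norm_eq_abs, norm_of_nonneg (mul_nonneg (pow_nonneg ht.le y) hgp)]
  gcongr
  exact rpow_le_self_of_le_one (cmpShape_nonneg n y) (cmpShape_le_one n y) hν

theorem hasSum_of_meanConstraint (n : ℕ) {μ l ν : ℝ} (hl : 0 < l) (hν : 1 ≤ ν)
    (h : meanConstraint μ l ν) :
    HasSum (fun y : ℕ => ((y : ℝ) - μ) * ((l / ((n : ℝ) + 1) ^ ν) ^ y * cmpShape n y ^ ν)) 0 := by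
  have hsum := summable_mul_cmpShape_rpow n μ (t := l / ((n : ℝ) + 1) ^ ν) (by positivity) hν
  unfold meanConstraint at h
  simp_rw [mul_div_assoc, cmp_weight_eq n _ hl ν, ← mul_assoc] at h
  rw [tsum_mul_right] at h
  have h0 := (mul_eq_zero.mp h).resolve_right (by positivity)
  simp_rw [mul_assoc] at h0
  exact h0 ▸ hsum.hasSum

theorem cmpZ_pos {l ν : ℝ} (hl : 0 < l) (hν : 1 ≤ ν) : 0 < cmpZ l ν := by
  refine Summable.tsum_pos ?_ (fun y => by positivity) 0 (by simp)
  refine Summable.of_nonneg_of_le (fun y => by positivity) (fun y => ?_)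
    (summable_pow_div_factorial l)
  gcongr
  exact self_le_rpow_of_one_le (by exact_mod_cast y.factorial_pos) hν

theorem cmpPmf_div_succ (n : ℕ) {l ν : ℝ} (hl : 0 < l) (hν : 1 ≤ ν) :
    cmpPmf l ν n / cmpPmf l ν (n + 1) = (l / ((n : ℝ) + 1) ^ ν)⁻¹ := by
  rw [cmpPmf, cmpPmf, div_div_div_cancel_right₀ (cmpZ_pos hl hν).ne', cmp_weight_eq n n hl,
    cmp_weight_eq n (n + 1) hl, cmpShape_self, cmpShape_succ, mul_div_mul_right _ _ (by positivity),
    one_rpow, mul_one, mul_one, pow_succ, div_mul_cancel_left₀ (by positivity)]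

/-- For non-integer `μ > 0` with `Δ = μ − ⌊μ⌋`, the ratio of CMP probabilities at
`⌊μ⌋` and `⌈μ⌉` eventually lies strictly between `1 − Δ` and `1/Δ`, and converges
to `(1 − Δ)/Δ` as `ν → ∞`. -/
theorem stmt17 (μ : ℝ) (hμ : 0 < μ) (hni : ¬ ∃ n : ℤ, (n : ℝ) = μ) (lam : ℝ → ℝ)
    (hlam : ∀ ν : ℝ, 0 < ν → 0 < lam ν ∧ meanConstraint μ (lam ν) ν) :
    (∀ᶠ ν in (atTop : Filter ℝ),
      1 - (μ - ⌊μ⌋₊) < cmpPmf (lam ν) ν ⌊μ⌋₊ / cmpPmf (lam ν) ν ⌈μ⌉₊ ∧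
      cmpPmf (lam ν) ν ⌊μ⌋₊ / cmpPmf (lam ν) ν ⌈μ⌉₊ < (μ - ⌊μ⌋₊)⁻¹) ∧
    Tendsto (fun ν : ℝ => cmpPmf (lam ν) ν ⌊μ⌋₊ / cmpPmf (lam ν) ν ⌈μ⌉₊) atTop
      (𝓝 ((1 - (μ - ⌊μ⌋₊)) / (μ - ⌊μ⌋₊))) := by
  set n := ⌊μ⌋₊ with hndef
  have hn : (n : ℝ) < μ := lt_of_le_of_ne (Nat.floor_le hμ.le) fun h => hni ⟨n, by simpa using h⟩
  have hn1 : μ < n + 1 := Nat.lt_floor_add_one μ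
  have hceil : ⌈μ⌉₊ = n + 1 := by
    rw [Nat.ceil_eq_iff (Nat.succ_ne_zero n)]
    exact ⟨by simpa using hn, by push_cast; exact hn1.le⟩
  rw [hceil]
  have hΔ0 : 0 < μ - n := sub_pos.mpr hn
  have hΔ1 : 0 < n + 1 - μ := sub_pos.mpr hn1
  have hx : Tendsto (fun ν => lam ν / ((n : ℝ) + 1) ^ ν) atTop (𝓝 ((μ - n) / (n + 1 - μ))) :=
    tendsto_of_hasSum_mean_zero hn hn1 (cmpShape_nonneg n) (cmpShape_self n) (cmpShape_succ n)
      (fun y => cmpShape_lt_one) (summable_abs_sub_mul_cmpShape n μ)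
      (fun ν hν => div_pos (hlam ν (by linarith)).1 (by positivity))
      (fun ν hν => hasSum_of_meanConstraint n (hlam ν (by linarith)).1 hν
        (hlam ν (by linarith)).2)
  have hlim : Tendsto (fun ν : ℝ => cmpPmf (lam ν) ν n / cmpPmf (lam ν) ν (n + 1)) atTop
      (𝓝 ((1 - (μ - n)) / (μ - n))) := by
    have h := hx.inv₀ (div_pos hΔ0 hΔ1).ne'
    rw [inv_div, show (n : ℝ) + 1 - μ = 1 - (μ - n) by ring] at h
    refine h.congr' ?_
    filter_upwards [eventually_ge_atTop 1] with ν hν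
    exact (cmpPmf_div_succ n (hlam ν (by linarith)).1 hν).symm
  refine ⟨(hlim.eventually_const_lt ?_).and (hlim.eventually_lt_const ?_), hlim⟩
  · rw [lt_div_iff₀ hΔ0]
    nlinarith
  · rw [inv_eq_one_div, div_lt_div_iff_of_pos_right hΔ0]
    linarith
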